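/- For y ∈ ℝ let s(y) = y − ⌊y + 1/2⌋ (the periodized sawtooth, taking values in [−1/2, 1/2)), and let G(t) = lim_{R→∞} ∫_{−R}^{R} s(t + η²/2) dη (which exists for every t). Then ∫₀¹ G(t) dt = 0, i.e. G has mean value zero over a period. -/

import Mathlib

open Filter

/-- The periodized sawtooth `s(y) = y − ⌊y + 1/2⌋`, taking values in `[−1/2, 1/2)`. -/
noncomputable def saw (y : ℝ) : ℝ := y - ⌊y + 1 / 2⌋

open MeasureTheory Set

lemma abs_saw_le (y : ℝ) : |saw y| ≤ 1 / 2 := by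
  simpa [saw, round_eq] using abs_sub_round y

lemma measurable_saw : Measurable saw := by
  unfold saw
  fun_prop

lemma saw_add_one (y : ℝ) : saw (y + 1) = saw y := by
  have h : y + 1 + 1 / 2 = y + 1 / 2 + 1 := by ring
  simp only [saw, h, Int.floor_add_one]
  push_cast
  ring

lemma continuous_saw_sq : Continuous fun y => saw y ^ 2 := by
  have h : (fun y => saw y ^ 2) = fun y : ℝ => ‖(y : UnitAddCircle)‖ ^ 2 := by
    funext y
    rw [UnitAddCircle.norm_eq, sq_abs, round_eq, saw]
  rw [h]
  exact (continuous_norm.comp (AddCircle.continuous_mk' 1)).pow 2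

lemma hasDerivAt_saw {y : ℝ} (hy : ∀ n : ℤ, y + 1 / 2 ≠ n) : HasDerivAt saw 1 y := by
  have hlt : (⌊y + 1 / 2⌋ : ℝ) < y + 1 / 2 := lt_of_le_of_ne (Int.floor_le _) (hy _).symm
  have hev : saw =ᶠ[nhds y] fun z => z - (⌊y + 1 / 2⌋ : ℝ) := by
    have hmem : Ioo ((⌊y + 1 / 2⌋ : ℝ) - 1 / 2) (⌊y + 1 / 2⌋ + 1 / 2) ∈ nhds y :=
      Ioo_mem_nhds (by linarith) (by linarith [Int.lt_floor_add_one (y + 1 / 2)])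
    filter_upwards [hmem] with z hz
    have hfloor : ⌊z + 1 / 2⌋ = ⌊y + 1 / 2⌋ :=
      Int.floor_eq_iff.2 ⟨by linarith [hz.1], by linarith [hz.2]⟩
    rw [saw, hfloor]
  exact ((hasDerivAt_id y).sub_const _).congr_of_eventuallyEq hev

lemma hasDerivAt_saw_sq_div_two {y : ℝ} (hy : ∀ n : ℤ, y + 1 / 2 ≠ n) :
    HasDerivAt (fun z => saw z ^ 2 / 2) (saw y) y := by
  refine HasDerivAt.congr_deriv (((hasDerivAt_saw hy).fun_pow 2).div_const 2) ?_
  simp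

/-- A bounded measurable function on a bounded interval is integrable. -/
lemma intervalIntegrable_of_measurable_of_abs_le {f : ℝ → ℝ} (hf : Measurable f) {C : ℝ}
    (hC : ∀ x, |f x| ≤ C) (a b : ℝ) : IntervalIntegrable f volume a b :=
  (intervalIntegrable_const (c := C)).mono_fun hf.aestronglyMeasurable
    (Eventually.of_forall fun x => (hC x).trans (le_abs_self C))

lemma integral_saw_add_eq_zero (c : ℝ) : ∫ t in (0 : ℝ)..1, saw (t + c) = 0 := by
  have key := integral_eq_of_hasDerivAt_off_countable (a := 0) (b := 1)
    (fun t => saw (t + c) ^ 2 / 2) (fun t => saw (t + c))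
    (countable_range fun n : ℤ => (n : ℝ) - 1 / 2 - c)
    ((continuous_saw_sq.comp (continuous_add_const c)).div_const 2).continuousOn
    (fun t ht => (hasDerivAt_saw_sq_div_two fun n hn =>
      ht.2 ⟨n, by simp only; linarith⟩).comp_add_const t c)
    (intervalIntegrable_of_measurable_of_abs_le (measurable_saw.comp (measurable_add_const c))
      (fun t => abs_saw_le _) 0 1)
  rw [key, zero_add, add_comm 1 c, saw_add_one, sub_self]

/-- The truncated integrals are bounded uniformly in the truncation and in the shift: integrate by
parts against the weight `η / (1 + η ^ 2)`. -/
lemma abs_integral_saw_le (t : ℝ) {R : ℝ} (hR : 0 ≤ R) :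
    |∫ η in (-R)..R, saw (t + η ^ 2 / 2)| ≤ 1 / 4 + 5 / 8 * Real.pi := by
  have hpos : ∀ η : ℝ, 0 < 1 + η ^ 2 := fun η => by positivity
  set F : ℝ → ℝ := fun η => saw (t + η ^ 2 / 2) ^ 2 / 2 * (η / (1 + η ^ 2)) with hF
  set F' : ℝ → ℝ := fun η => saw (t + η ^ 2 / 2) * η * (η / (1 + η ^ 2)) +
    saw (t + η ^ 2 / 2) ^ 2 / 2 * ((1 - η ^ 2) / (1 + η ^ 2) ^ 2) with hF'
  have hsq : ∀ y, saw y ^ 2 ≤ 1 / 4 := fun y => by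
    have := abs_le.1 (abs_saw_le y)
    nlinarith
  have hFbound : ∀ η, |F η| ≤ 1 / 8 := fun η => by
    have hw : |η / (1 + η ^ 2)| ≤ 1 := by
      rw [abs_div, abs_of_pos (hpos η), div_le_one (hpos η), ← sq_abs]
      nlinarith [sq_nonneg (|η| - 1)]
    rw [hF, abs_mul, abs_of_nonneg (by positivity)]
    have hP : saw (t + η ^ 2 / 2) ^ 2 / 2 ≤ 1 / 8 := by linarith [hsq (t + η ^ 2 / 2)]
    simpa using mul_le_mul hP hw (abs_nonneg _) (by norm_num)
  have hsaw : IntervalIntegrable (fun η => saw (t + η ^ 2 / 2)) volume (-R) R :=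
    intervalIntegrable_of_measurable_of_abs_le (measurable_saw.comp (by fun_prop))
      (fun η => abs_saw_le _) _ _
  have hrem : ∀ η, |saw (t + η ^ 2 / 2) - F' η| ≤ 5 / 8 * (1 + η ^ 2)⁻¹ := fun η => by
    have heq : saw (t + η ^ 2 / 2) - F' η = (saw (t + η ^ 2 / 2) -
        saw (t + η ^ 2 / 2) ^ 2 / 2 * ((1 - η ^ 2) / (1 + η ^ 2))) * (1 + η ^ 2)⁻¹ := by
      have := (hpos η).ne'
      simp only [hF']
      field_simp
      ring
    have hq : |(1 - η ^ 2) / (1 + η ^ 2)| ≤ 1 := by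
      rw [abs_div, abs_of_pos (hpos η), div_le_one (hpos η), abs_le]
      constructor <;> nlinarith [sq_nonneg η]
    rw [heq, abs_mul, abs_of_pos (inv_pos.2 (hpos η))]
    have := hpos η
    gcongr
    calc _ ≤ |saw (t + η ^ 2 / 2)| +
          |saw (t + η ^ 2 / 2) ^ 2 / 2 * ((1 - η ^ 2) / (1 + η ^ 2))| := abs_sub _ _
      _ ≤ 1 / 2 + 1 / 8 * 1 := by
          rw [abs_mul, abs_of_nonneg (a := saw (t + η ^ 2 / 2) ^ 2 / 2) (by positivity)]
          exact add_le_add (abs_saw_le _) (mul_le_mul (by linarith [hsq (t + η ^ 2 / 2)]) hq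
            (abs_nonneg _) (by norm_num))
      _ = 5 / 8 := by norm_num
  have hinv : Continuous fun η : ℝ => (1 + η ^ 2)⁻¹ :=
    (by fun_prop : Continuous fun η : ℝ => 1 + η ^ 2).inv₀ fun η => (hpos η).ne'
  have hbd : IntervalIntegrable (fun η : ℝ => 5 / 8 * (1 + η ^ 2)⁻¹) volume (-R) R :=
    (hinv.const_mul _).intervalIntegrable _ _
  have hcompMeas : Measurable fun η => saw (t + η ^ 2 / 2) :=
    measurable_saw.comp (by fun_prop)
  have hF'meas : Measurable F' := by
    fun_prop
  have hremInt : IntervalIntegrable (fun η => saw (t + η ^ 2 / 2) - F' η) volume (-R) R :=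
    hbd.mono_fun (hcompMeas.sub hF'meas).aestronglyMeasurable
      (Eventually.of_forall fun η => (hrem η).trans (le_abs_self _))
  have hF'int : IntervalIntegrable F' volume (-R) R := by
    simpa using hsaw.sub hremInt
  have hFcont : Continuous F :=
    ((continuous_saw_sq.comp (by fun_prop : Continuous fun η : ℝ => t + η ^ 2 / 2)).div_const
      2).mul (continuous_id.div (by fun_prop) fun η => (hpos η).ne')
  have hFTC : ∫ η in (-R)..R, F' η = F R - F (-R) := by
    refine integral_eq_of_hasDerivAt_off_countable F F'
      ((countable_range fun n : ℤ => √(2 * (n - 1 / 2 - t))).union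
        (countable_range fun n : ℤ => -√(2 * (n - 1 / 2 - t)))) hFcont.continuousOn ?_ hF'int
    rintro η ⟨-, hη⟩
    have hy : ∀ n : ℤ, t + η ^ 2 / 2 + 1 / 2 ≠ n := fun n hn => by
      have hroot : √(2 * (n - 1 / 2 - t)) = |η| := by
        rw [← Real.sqrt_sq_eq_abs]
        congr 1
        linarith
      rcases abs_choice η with h | h
      · exact hη (Or.inl ⟨n, hroot.trans h⟩)
      · exact hη (Or.inr ⟨n, by simp only [hroot, h, neg_neg]⟩)
    have hinner : HasDerivAt (fun η : ℝ => t + η ^ 2 / 2) η η := by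
      refine HasDerivAt.congr_deriv ((((hasDerivAt_id' η).fun_pow 2).div_const 2).const_add t) ?_
      simp
    have hweight : HasDerivAt (fun η : ℝ => η / (1 + η ^ 2))
        ((1 - η ^ 2) / (1 + η ^ 2) ^ 2) η := by
      refine HasDerivAt.congr_deriv ((hasDerivAt_id' η).fun_div
        (((hasDerivAt_id' η).fun_pow 2).const_add 1) (hpos η).ne') ?_
      simp
      ring
    exact ((hasDerivAt_saw_sq_div_two hy).comp η hinner).mul hweight
  have hsplit : ∫ η in (-R)..R, saw (t + η ^ 2 / 2) =
      (F R - F (-R)) + ∫ η in (-R)..R, (saw (t + η ^ 2 / 2) - F' η) := by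
    rw [intervalIntegral.integral_sub hsaw hF'int, hFTC]
    ring
  have hremBound : |∫ η in (-R)..R, (saw (t + η ^ 2 / 2) - F' η)| ≤ 5 / 8 * Real.pi := by
    refine (intervalIntegral.norm_integral_le_of_norm_le
      (f := fun η => saw (t + η ^ 2 / 2) - F' η) (by linarith)
      (Eventually.of_forall fun η _ => hrem η) hbd).trans ?_
    rw [intervalIntegral.integral_const_mul, integral_inv_one_add_sq, Real.arctan_neg]
    linarith [Real.arctan_lt_pi_div_two R]
  rw [hsplit, abs_le]
  have h₁ := abs_le.1 (hFbound R)
  have h₂ := abs_le.1 (hFbound (-R))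
  have h₃ := abs_le.1 hremBound
  constructor <;> linarith

lemma measurable_saw_uncurry :
    Measurable (Function.uncurry fun t η : ℝ => saw (t + η ^ 2 / 2)) :=
  measurable_saw.comp (by fun_prop)

lemma integral_integral_saw_eq_zero (R : ℝ) :
    ∫ t in (0 : ℝ)..1, ∫ η in (-R)..R, saw (t + η ^ 2 / 2) = 0 := by
  rw [intervalIntegral_intervalIntegral_swap]
  · simp only [integral_saw_add_eq_zero, intervalIntegral.integral_zero]
  · refine Measure.integrableOn_of_bounded (M := 1 / 2) ?_
      measurable_saw_uncurry.aestronglyMeasurable (Eventually.of_forall fun p => abs_saw_le _)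
    simp [Measure.volume_eq_prod, Measure.prod_prod, uIoc]

/-- the function `G(t) = lim_{R→∞} ∫_{−R}^{R} s(t + η²/2) dη`
has mean value zero over a period: `∫₀¹ G(t) dt = 0`. -/
theorem stmt_18 (G : ℝ → ℝ)
    (hG : ∀ t : ℝ,
      Tendsto (fun R : ℝ => ∫ η in (-R)..R, saw (t + η ^ 2 / 2)) atTop (nhds (G t))) :
    ∫ t in (0:ℝ)..1, G t = 0 := by
  have hlim : Tendsto (fun R : ℝ => ∫ t in (0 : ℝ)..1, ∫ η in (-R)..R, saw (t + η ^ 2 / 2)) atTop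
      (nhds (∫ t in (0 : ℝ)..1, G t)) := by
    refine intervalIntegral.tendsto_integral_filter_of_dominated_convergence
      (fun _ => 1 / 4 + 5 / 8 * Real.pi) ?_ ?_ intervalIntegrable_const
      (Eventually.of_forall fun t _ => hG t)
    · filter_upwards [eventually_ge_atTop 0] with R hR
      simp only [intervalIntegral.integral_of_le (neg_le_self hR)]
      exact measurable_saw_uncurry.stronglyMeasurable.integral_prod_right'.aestronglyMeasurable
    · filter_upwards [eventually_ge_atTop 0] with R hR
      exact Eventually.of_forall fun t _ => abs_integral_saw_le t hR
  simp only [integral_integral_saw_eq_zero] at hlim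
  exact tendsto_nhds_unique hlim tendsto_const_nhds
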